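/- Let δ > 0, D_y > 0, h > 0 and C > 0 be real numbers. For x > 0 let A(x) = arsinh( D_y / (2·√x) ), define the inverse-tangent integral Ti₂(z) = ∫₀^{z} arctan(t)/t dt for real z, and define the closed-form functions Î_i(x) = (δ·D_y/4)·ln(D_y²/4 + δ²/4 + x) − δ·D_y/2 + δ·√(δ²/4 + x)·arctan( D_y/(2·√(x + δ²/4)) ), and Î_j(x) = [ (D_y/2)·√(x + D_y²/4) + x·ln( D_y/2 + √(x + D_y²/4) ) ]·arctan( δ/(2·√(x + D_y²/4)) ) − x·ln(√x)·arctan( δ/(2·√x) ) + δ·D_y/4 − (δ/2)·√(x + δ²/4)·arctan( D_y/(2·√(x + δ²/4)) ) + x·[ ( ln(√x) + A(x) )·arctan( √(4x + D_y²)/δ ) − ln(√x)·arctan( 2·√x/δ ) − (π/2)·A(x) − Ti₂( e^{A(x)}·(δ/(2·√x))·(√(1 + 4x/δ²) − 1) ) + Ti₂( (δ/(2·√x))·(√(1 + 4x/δ²) − 1) ) − Ti₂( −e^{A(x)}·(δ/(2·√x))·(√(1 + 4x/δ²) + 1) ) + Ti₂( −(δ/(2·√x))·(√(1 + 4x/δ²)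 + 1) ) ]. Then the ergodic rate satisfies (1/(δ·D_y)) · ∫_{−δ/2}^{δ/2} ∫_{−D_y/2}^{D_y/2} ln( 1 + C/(h² + ε² + y²) ) / ln 2 dy dε = (4/(δ·D_y·ln 2)) · ( Î_i(C + h²) + Î_j(C + h²) − Î_i(h²) − Î_j(h²) ). -/

import Mathlib

open Real

/-- The inverse-tangent integral Ti₂(z) = ∫₀^z arctan t / t dt. -/
noncomputable def Ti2 (z : ℝ) : ℝ := ∫ t in (0:ℝ)..z, Real.arctan t / t

/-- The closed-form function Î_i(x). -/
noncomputable def IiHat (δ Dy x : ℝ) : ℝ :=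
  (δ * Dy / 4) * Real.log (Dy ^ 2 / 4 + δ ^ 2 / 4 + x) - δ * Dy / 2 +
    δ * Real.sqrt (δ ^ 2 / 4 + x) * Real.arctan (Dy / (2 * Real.sqrt (x + δ ^ 2 / 4)))

/-- The closed-form function Î_j(x). -/
noncomputable def IjHat (δ Dy x : ℝ) : ℝ :=
  ((Dy / 2) * Real.sqrt (x + Dy ^ 2 / 4) +
      x * Real.log (Dy / 2 + Real.sqrt (x + Dy ^ 2 / 4))) *
      Real.arctan (δ / (2 * Real.sqrt (x + Dy ^ 2 / 4)))
    - x * Real.log (Real.sqrt x) * Real.arctan (δ / (2 * Real.sqrt x))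
    + δ * Dy / 4
    - (δ / 2) * Real.sqrt (x + δ ^ 2 / 4) *
        Real.arctan (Dy / (2 * Real.sqrt (x + δ ^ 2 / 4)))
    + x * ((Real.log (Real.sqrt x) + Real.arsinh (Dy / (2 * Real.sqrt x))) *
          Real.arctan (Real.sqrt (4 * x + Dy ^ 2) / δ)
        - Real.log (Real.sqrt x) * Real.arctan (2 * Real.sqrt x / δ)
        - (Real.pi / 2) * Real.arsinh (Dy / (2 * Real.sqrt x))
        - Ti2 (Real.exp (Real.arsinh (Dy / (2 * Real.sqrt x))) * (δ / (2 * Real.sqrt x)) *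
            (Real.sqrt (1 + 4 * x / δ ^ 2) - 1))
        + Ti2 ((δ / (2 * Real.sqrt x)) * (Real.sqrt (1 + 4 * x / δ ^ 2) - 1))
        - Ti2 (-(Real.exp (Real.arsinh (Dy / (2 * Real.sqrt x))) * (δ / (2 * Real.sqrt x)) *
            (Real.sqrt (1 + 4 * x / δ ^ 2) + 1)))
        + Ti2 (-((δ / (2 * Real.sqrt x)) * (Real.sqrt (1 + 4 * x / δ ^ 2) + 1))))

/-- The integrand of `Ti2` is interval integrable on every bounded interval. -/
theorem intervalIntegrable_arctan_div (u v : ℝ) :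
    IntervalIntegrable (fun t : ℝ => arctan t / t) MeasureTheory.volume u v := by
  have hc : Continuous (dslope arctan 0) := by
    rw [← continuousOn_univ, continuousOn_dslope Filter.univ_mem]
    exact ⟨continuous_arctan.continuousOn, differentiable_arctan 0⟩
  refine (hc.intervalIntegrable u v).congr_ae ?_
  refine MeasureTheory.ae_restrict_of_ae ?_
  filter_upwards [MeasureTheory.Measure.ae_ne MeasureTheory.volume (0 : ℝ)] with t ht
  rw [dslope_of_ne _ ht, slope_def_field]
  simp

theorem Ti2_neg (z : ℝ) : Ti2 (-z) = -Ti2 z := by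
  have h := intervalIntegral.integral_comp_neg (a := 0) (b := z) (fun t : ℝ => arctan t / t)
  simp only [arctan_neg, neg_div_neg_eq, neg_zero] at h
  rw [Ti2, Ti2, intervalIntegral.integral_symm, ← h]

theorem hasDerivAt_Ti2 {z : ℝ} (hz : z ≠ 0) : HasDerivAt Ti2 (arctan z / z) z := by
  have hc : ContinuousAt (fun t : ℝ => arctan t / t) z :=
    continuous_arctan.continuousAt.div continuousAt_id hz
  have hm : Measurable (fun t : ℝ => arctan t / t) := measurable_arctan.div measurable_id
  exact intervalIntegral.integral_hasDerivAt_right (intervalIntegrable_arctan_div 0 z)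
    hm.stronglyMeasurable.stronglyMeasurableAtFilter hc

theorem hasDerivAt_Ti2_exp_mul {f : ℝ → ℝ} {f' c y : ℝ} (hf : HasDerivAt f f' y) (hc : 0 < c) :
    HasDerivAt (fun t => Ti2 (exp (f t) * c)) (arctan (exp (f y) * c) * f') y := by
  have hz : exp (f y) * c ≠ 0 := (mul_pos (exp_pos _) hc).ne'
  refine ((hasDerivAt_Ti2 hz).comp y (hf.exp.mul_const c)).congr_deriv ?_
  have := (exp_pos (f y)).ne'
  field_simp

theorem arctan_sub_arctan_of_mul_nonneg {u v : ℝ} (h : 0 ≤ u * v) :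
    arctan u - arctan v = arctan ((u - v) / (1 + u * v)) := by
  rw [sub_eq_add_neg, ← arctan_neg, arctan_add (by nlinarith)]
  congr 1
  ring

theorem exp_arsinh_div_sqrt {x : ℝ} (hx : 0 < x) (y : ℝ) :
    exp (arsinh (y / √x)) = (y + √(x + y ^ 2)) / √x := by
  have h : 1 + (y / √x) ^ 2 = (x + y ^ 2) / x := by
    rw [div_pow, sq_sqrt hx.le]
    field_simp
  rw [exp_arsinh, h, sqrt_div' _ hx.le, add_div]

theorem hasDerivAt_arsinh_div_sqrt {x : ℝ} (hx : 0 < x) (y : ℝ) :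
    HasDerivAt (fun t => arsinh (t / √x)) (1 / √(x + y ^ 2)) y := by
  have hs := sqrt_pos.2 hx
  have hq : 0 < √(x + y ^ 2) := sqrt_pos.2 (by positivity)
  convert ((hasDerivAt_id' y).div_const √x).arsinh using 1
  have h : 1 + (y / √x) ^ 2 = (x + y ^ 2) / x := by
    rw [div_pow, sq_sqrt hx.le]
    field_simp
  rw [h, sqrt_div' _ hx.le, smul_eq_mul]
  field_simp

theorem hasDerivAt_sqrt_add_sq {x : ℝ} (hx : 0 < x) (y : ℝ) :
    HasDerivAt (fun t => √(x + t ^ 2)) (y / √(x + y ^ 2)) y := by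
  have h : x + y ^ 2 ≠ 0 := by positivity
  refine (((hasDerivAt_pow 2 y).const_add x).sqrt h).congr_deriv ?_
  field_simp
  simp

theorem hasDerivAt_log_add_sq {x : ℝ} (hx : 0 < x) (y : ℝ) :
    HasDerivAt (fun t => log (x + t ^ 2)) (2 * y / (x + y ^ 2)) y := by
  have h : x + y ^ 2 ≠ 0 := by positivity
  refine (((hasDerivAt_pow 2 y).const_add x).log h).congr_deriv ?_
  simp

theorem hasDerivAt_arctan_div {p : ℝ} (hp : 0 < p) (y : ℝ) :
    HasDerivAt (fun t => arctan (t / √p)) (√p / (p + y ^ 2)) y := by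
  have hs := sqrt_pos.2 hp
  convert ((hasDerivAt_id' y).div_const √p).arctan using 1
  have h : 1 + (y / √p) ^ 2 = (p + y ^ 2) / p := by
    rw [div_pow, sq_sqrt hp.le]
    field_simp
  rw [h]
  have : p + y ^ 2 ≠ 0 := by positivity
  field_simp
  exact sq_sqrt hp.le

theorem hasDerivAt_arctan_div_sqrt_add_sq (a : ℝ) {x : ℝ} (hx : 0 < x) (y : ℝ) :
    HasDerivAt (fun t => arctan (a / √(x + t ^ 2)))
      (-(a * y) / (√(x + y ^ 2) * (x + a ^ 2 + y ^ 2))) y := by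
  have hq : 0 < √(x + y ^ 2) := sqrt_pos.2 (by positivity)
  have hq2 : √(x + y ^ 2) ^ 2 = x + y ^ 2 := sq_sqrt (by positivity)
  convert ((hasDerivAt_const y a).fun_div (hasDerivAt_sqrt_add_sq hx y) hq.ne').arctan using 1
  rw [show x + a ^ 2 + y ^ 2 = √(x + y ^ 2) ^ 2 + a ^ 2 by rw [hq2]; ring]
  have h1 : √(x + y ^ 2) ^ 2 + a ^ 2 ≠ 0 := by positivity
  field_simp
  ring

theorem integral_log_add_sq {p : ℝ} (hp : 0 < p) (a : ℝ) :
    ∫ ε in (-a)..a, log (p + ε ^ 2) =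
      2 * (a * log (p + a ^ 2) - 2 * a + 2 * √p * arctan (a / √p)) := by
  have hd : ∀ y ∈ Set.uIcc (-a) a,
      HasDerivAt (fun t => t * log (p + t ^ 2) - 2 * t + 2 * √p * arctan (t / √p))
        (log (p + y ^ 2)) y := by
    intro y _
    refine ((((hasDerivAt_id' y).fun_mul (hasDerivAt_log_add_sq hp y)).fun_sub
      ((hasDerivAt_id' y).const_mul 2)).fun_add
      ((hasDerivAt_arctan_div hp y).const_mul (2 * √p))).congr_deriv ?_
    have h : p + y ^ 2 ≠ 0 := by positivity
    field_simp
    rw [sq_sqrt hp.le]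
    ring
  have hc : Continuous fun y : ℝ => log (p + y ^ 2) :=
    Continuous.log (by fun_prop) fun y => by positivity
  rw [intervalIntegral.integral_eq_sub_of_hasDerivAt hd (hc.intervalIntegrable _ _)]
  simp only [neg_sq, neg_div, arctan_neg]
  ring

/-- A primitive in `y` of `a * log (x + a ^ 2 + y ^ 2) - 2 * a + 2 * √(x + y ^ 2) *
arctan (a / √(x + y ^ 2))`, vanishing at `y = 0`. -/
noncomputable def logRectPrimitive (a x y : ℝ) : ℝ :=
  a * y * log (x + a ^ 2 + y ^ 2) - 3 * (a * y) +
    a * √(x + a ^ 2) * arctan (y / √(x + a ^ 2)) + y * √(x + y ^ 2) * arctan (a / √(x + y ^ 2)) +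
    x * (Ti2 (exp (arsinh (y / √x)) * ((√(x + a ^ 2) + a) / √x)) -
      Ti2 (exp (arsinh (y / √x)) * ((√(x + a ^ 2) - a) / √x)) -
      Ti2 ((√(x + a ^ 2) + a) / √x) + Ti2 ((√(x + a ^ 2) - a) / √x))

theorem logRectPrimitive_zero (a x : ℝ) : logRectPrimitive a x 0 = 0 := by
  simp [logRectPrimitive]

theorem arctan_exp_arsinh_sub {x : ℝ} (hx : 0 < x) (a y : ℝ) :
    arctan (exp (arsinh (y / √x)) * ((√(x + a ^ 2) + a) / √x)) -
      arctan (exp (arsinh (y / √x)) * ((√(x + a ^ 2) - a) / √x)) =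
      arctan (a / √(x + y ^ 2)) := by
  have hs := sqrt_pos.2 hx
  have hs2 : √x ^ 2 = x := sq_sqrt hx.le
  have hq : 0 < √(x + y ^ 2) := sqrt_pos.2 (by positivity)
  have hq2 : √(x + y ^ 2) ^ 2 = x + y ^ 2 := sq_sqrt (by positivity)
  have hr2 : √(x + a ^ 2) ^ 2 = x + a ^ 2 := sq_sqrt (by positivity)
  have hprod : (√(x + a ^ 2) + a) / √x * ((√(x + a ^ 2) - a) / √x) = 1 := by
    field_simp
    linear_combination hr2 - hs2
  set E := exp (arsinh (y / √x)) with hE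
  have hEpos : 0 < E := exp_pos _
  have hmul : E * ((√(x + a ^ 2) + a) / √x) * (E * ((√(x + a ^ 2) - a) / √x)) = E ^ 2 := by
    linear_combination E ^ 2 * hprod
  rw [arctan_sub_arctan_of_mul_nonneg (by rw [hmul]; positivity), hmul]
  congr 1
  have hE' : E * √x = y + √(x + y ^ 2) := by
    rw [hE, exp_arsinh_div_sqrt hx]
    field_simp
  have hE2 : 2 * √(x + y ^ 2) * E = √x * (1 + E ^ 2) := by
    apply mul_right_cancel₀ hs.ne'
    linear_combination (2 * √(x + y ^ 2) - (y + √(x + y ^ 2)) - E * √x) * hE' - hs2 + hq2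
  have h1 : 1 + E ^ 2 ≠ 0 := by positivity
  field_simp
  linear_combination a * hE2

theorem hasDerivAt_logRectPrimitive (a : ℝ) {x : ℝ} (hx : 0 < x) (y : ℝ) :
    HasDerivAt (logRectPrimitive a x)
      (a * log (x + a ^ 2 + y ^ 2) - 2 * a + 2 * √(x + y ^ 2) * arctan (a / √(x + y ^ 2))) y := by
  have hs := sqrt_pos.2 hx
  have hxa : 0 < x + a ^ 2 := by positivity
  have hq : 0 < √(x + y ^ 2) := sqrt_pos.2 (by positivity)
  have hq2 : √(x + y ^ 2) ^ 2 = x + y ^ 2 := sq_sqrt (by positivity)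
  have hr2 : √(x + a ^ 2) ^ 2 = x + a ^ 2 := sq_sqrt hxa.le
  have habs : |a| < √(x + a ^ 2) := by
    rw [← sqrt_sq_eq_abs]
    exact sqrt_lt_sqrt (sq_nonneg a) (by linarith)
  have hc₁ : 0 < (√(x + a ^ 2) + a) / √x := div_pos (by linarith [neg_abs_le a]) hs
  have hc₂ : 0 < (√(x + a ^ 2) - a) / √x := div_pos (by linarith [le_abs_self a]) hs
  have hA := hasDerivAt_arsinh_div_sqrt hx y
  have hay : HasDerivAt (fun t => a * t) a y := by
    simpa using (hasDerivAt_id' y).const_mul a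
  have h := ((((hay.fun_mul (hasDerivAt_log_add_sq hxa y)).fun_sub (hay.const_mul 3)).fun_add
    ((hasDerivAt_arctan_div hxa y).const_mul (a * √(x + a ^ 2)))).fun_add
    (((hasDerivAt_id' y).fun_mul (hasDerivAt_sqrt_add_sq hx y)).fun_mul
      (hasDerivAt_arctan_div_sqrt_add_sq a hx y))).fun_add
    (((((hasDerivAt_Ti2_exp_mul hA hc₁).fun_sub (hasDerivAt_Ti2_exp_mul hA hc₂)).sub_const
      (Ti2 ((√(x + a ^ 2) + a) / √x))).add_const (Ti2 ((√(x + a ^ 2) - a) / √x))).const_mul x)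
  refine h.congr_deriv ?_
  rw [← sub_mul, arctan_exp_arsinh_sub hx]
  have hR : x + a ^ 2 + y ^ 2 ≠ 0 := by positivity
  generalize arctan (a / √(x + y ^ 2)) = T
  generalize log (x + a ^ 2 + y ^ 2) = L
  generalize √(x + y ^ 2) = q at *
  generalize √(x + a ^ 2) = r at *
  have hx' : x = q ^ 2 - y ^ 2 := by linarith
  subst hx'
  field_simp
  rw [hr2]
  ring

theorem integral_integral_log (a b : ℝ) {x : ℝ} (hx : 0 < x) :
    ∫ y in (-b)..b, ∫ ε in (-a)..a, log (x + ε ^ 2 + y ^ 2) = 4 * logRectPrimitive a x b := by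
  have hcont : Continuous fun y => a * log (x + a ^ 2 + y ^ 2) - 2 * a +
      2 * √(x + y ^ 2) * arctan (a / √(x + y ^ 2)) := by
    have h₁ : Continuous fun y : ℝ => log (x + a ^ 2 + y ^ 2) :=
      Continuous.log (by fun_prop) fun y => by positivity
    have h₂ : Continuous fun y : ℝ => a / √(x + y ^ 2) :=
      Continuous.div (by fun_prop) (by fun_prop) fun y => (sqrt_pos.2 (by positivity)).ne'
    have h₃ := continuous_arctan.comp h₂
    simp only [Function.comp_def] at h₃
    fun_prop
  have hinner : ∀ y : ℝ, ∫ ε in (-a)..a, log (x + ε ^ 2 + y ^ 2) =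
      2 * (a * log (x + a ^ 2 + y ^ 2) - 2 * a +
        2 * √(x + y ^ 2) * arctan (a / √(x + y ^ 2))) := by
    intro y
    have h := integral_log_add_sq (show 0 < x + y ^ 2 by positivity) a
    simpa only [add_right_comm x (y ^ 2)] using h
  have hright := intervalIntegral.integral_eq_sub_of_hasDerivAt (a := 0) (b := b)
    (fun y _ => hasDerivAt_logRectPrimitive a hx y) (hcont.intervalIntegrable _ _)
  have hleft := intervalIntegral.integral_comp_neg (a := 0) (b := b)
    (fun y => a * log (x + a ^ 2 + y ^ 2) - 2 * a +
      2 * √(x + y ^ 2) * arctan (a / √(x + y ^ 2)))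
  simp only [neg_sq, neg_zero] at hleft
  simp_rw [hinner]
  rw [intervalIntegral.integral_const_mul,
    ← intervalIntegral.integral_add_adjacent_intervals (b := 0)
      (hcont.intervalIntegrable _ _) (hcont.intervalIntegrable _ _),
    ← hleft, hright, logRectPrimitive_zero]
  ring

theorem IiHat_add_IjHat {a b x : ℝ} (ha : 0 < a) (hx : 0 < x) :
    IiHat (2 * a) (2 * b) x + IjHat (2 * a) (2 * b) x =
      logRectPrimitive a x b + 2 * (a * b) := by
  have hs := sqrt_pos.2 hx
  have hq : 0 < √(x + b ^ 2) := sqrt_pos.2 (by positivity)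
  have hlog : log (b + √(x + b ^ 2)) = log √x + arsinh (b / √x) := by
    rw [← log_exp (arsinh (b / √x)), ← log_mul hs.ne' (exp_pos _).ne', exp_arsinh_div_sqrt hx]
    congr 1
    field_simp
  have hk : √(1 + 4 * x / (2 * a) ^ 2) = √(x + a ^ 2) / a := by
    rw [show 1 + 4 * x / (2 * a) ^ 2 = (x + a ^ 2) / a ^ 2 by field_simp; ring,
      sqrt_div' _ (sq_nonneg a), sqrt_sq ha.le]
  have h4 : √(4 * x + (2 * b) ^ 2) = 2 * √(x + b ^ 2) := by
    rw [show 4 * x + (2 * b) ^ 2 = 2 ^ 2 * (x + b ^ 2) by ring, sqrt_mul (by norm_num),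
      sqrt_sq (by norm_num)]
  have ht₁ : arctan (√(x + b ^ 2) / a) = π / 2 - arctan (a / √(x + b ^ 2)) := by
    rw [← arctan_inv_of_pos (by positivity), inv_div]
  have ht₂ : arctan (√x / a) = π / 2 - arctan (a / √x) := by
    rw [← arctan_inv_of_pos (by positivity), inv_div]
  have hc₁ : a / √x * (√(x + a ^ 2) / a - 1) = (√(x + a ^ 2) - a) / √x := by field_simp
  have hc₂ : a / √x * (√(x + a ^ 2) / a + 1) = (√(x + a ^ 2) + a) / √x := by field_simp
  have hb4 : (2 * b) ^ 2 / 4 = b ^ 2 := by ring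
  have ha4 : (2 * a) ^ 2 / 4 = a ^ 2 := by ring
  have hd (u v : ℝ) : 2 * u / (2 * v) = u / v := mul_div_mul_left u v two_ne_zero
  have hb2 : 2 * b / 2 = b := by ring
  have ha2 : 2 * a / 2 = a := by ring
  simp only [IiHat, IjHat, logRectPrimitive, hk, h4, hb4, ha4, hd, ha2, hb2, hlog, ht₁, ht₂,
    mul_assoc (exp _), hc₁, hc₂, Ti2_neg, add_comm (a ^ 2) x,
    show b ^ 2 + a ^ 2 + x = x + a ^ 2 + b ^ 2 by ring]
  ring

theorem ergodic_rate_closed_form (δ Dy h C : ℝ)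
    (hδ : 0 < δ) (hDy : 0 < Dy) (hh : 0 < h) (hC : 0 < C) :
    (1 / (δ * Dy)) *
        ∫ ε in (-(δ / 2))..(δ / 2), ∫ y in (-(Dy / 2))..(Dy / 2),
          Real.log (1 + C / (h ^ 2 + ε ^ 2 + y ^ 2)) / Real.log 2 =
      (4 / (δ * Dy * Real.log 2)) *
        (IiHat δ Dy (C + h ^ 2) + IjHat δ Dy (C + h ^ 2)
          - IiHat δ Dy (h ^ 2) - IjHat δ Dy (h ^ 2)) := by
  obtain ⟨a, rfl⟩ : ∃ a, δ = 2 * a := ⟨δ / 2, by ring⟩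
  obtain ⟨b, rfl⟩ : ∃ b, Dy = 2 * b := ⟨Dy / 2, by ring⟩
  have ha : 0 < a := by linarith
  have hh2 : 0 < h ^ 2 := by positivity
  have hX : 0 < C + h ^ 2 := by positivity
  have hcont {x : ℝ} (hx : 0 < x) : Continuous fun p : ℝ × ℝ => log (x + p.1 ^ 2 + p.2 ^ 2) :=
    Continuous.log (by fun_prop) fun p => by positivity
  have hsplit (ε y : ℝ) : log (1 + C / (h ^ 2 + ε ^ 2 + y ^ 2)) =
      log (C + h ^ 2 + ε ^ 2 + y ^ 2) - log (h ^ 2 + ε ^ 2 + y ^ 2) := by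
    have : h ^ 2 + ε ^ 2 + y ^ 2 ≠ 0 := by positivity
    rw [← log_div (by positivity) this]
    congr 1
    field_simp
    ring
  have hswap {x : ℝ} (hx : 0 < x) :
      ∫ ε in (-a)..a, ∫ y in (-b)..b, log (x + ε ^ 2 + y ^ 2) = 4 * logRectPrimitive a x b := by
    rw [← integral_integral_log a b hx]
    refine MeasureTheory.intervalIntegral_intervalIntegral_swap
      (F := fun ε y => log (x + ε ^ 2 + y ^ 2)) ?_
    exact ((hcont hx).continuousOn.integrableOn_compact
      (isCompact_uIcc.prod isCompact_uIcc)).mono_set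
      (Set.prod_mono Set.uIoc_subset_uIcc Set.uIoc_subset_uIcc)
  have hinner {x : ℝ} (hx : 0 < x) :
      Continuous fun ε : ℝ => ∫ y in (-b)..b, log (x + ε ^ 2 + y ^ 2) :=
    intervalIntegral.continuous_parametric_intervalIntegral_of_continuous' (hcont hx) _ _
  have hslice {x : ℝ} (hx : 0 < x) (ε : ℝ) :
      Continuous fun y : ℝ => log (x + ε ^ 2 + y ^ 2) :=
    (hcont hx).comp (Continuous.prodMk_right ε)
  have hsub : ∫ ε in (-a)..a, ∫ y in (-b)..b, log (1 + C / (h ^ 2 + ε ^ 2 + y ^ 2)) =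
      4 * logRectPrimitive a (C + h ^ 2) b - 4 * logRectPrimitive a (h ^ 2) b := by
    rw [← hswap hX, ← hswap hh2, ← intervalIntegral.integral_sub
      ((hinner hX).intervalIntegrable _ _) ((hinner hh2).intervalIntegrable _ _)]
    congr 1 with ε
    rw [← intervalIntegral.integral_sub ((hslice hX ε).intervalIntegrable _ _)
      ((hslice hh2 ε).intervalIntegrable _ _)]
    simp only [hsplit]
  have hF : IiHat (2 * a) (2 * b) (C + h ^ 2) + IjHat (2 * a) (2 * b) (C + h ^ 2) -
      IiHat (2 * a) (2 * b) (h ^ 2) - IjHat (2 * a) (2 * b) (h ^ 2) =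
      logRectPrimitive a (C + h ^ 2) b - logRectPrimitive a (h ^ 2) b := by
    linear_combination IiHat_add_IjHat (b := b) ha hX - IiHat_add_IjHat (b := b) ha hh2
  rw [hF, mul_div_cancel_left₀ a two_ne_zero, mul_div_cancel_left₀ b two_ne_zero]
  simp only [intervalIntegral.integral_div, hsub]
  field_simp
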